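/- Under the exponential type model, for any actual present-bias factor β ∈ [0,1] and any penalty z ≥ -β·w, the expected social welfare generated by an assigned agent equals E[(V + w)·1{V ≥ -z - β·w}] = w - 1/λ + e^{-λ(β·w + z)}·(1/λ - (1 - β)·w + z). -/

import Mathlib

open MeasureTheory Real Set Filter ProbabilityTheory
open scoped ENNReal

/-- The subjective expected utility of an agent with immediate value `V`, future value `w`,
subjective present-bias factor `βh`, facing no-show penalty `z`:
`û(z) = E[(V + w)·1{V ≥ -z - β̂·w}] - z·P(V < -z - β̂·w)`. -/
noncomputable def uhat {Ω : Type*} [MeasurableSpace Ω] (P : Measure Ω)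
    (V : Ω → ℝ) (w βh : ℝ) (z : ℝ) : ℝ :=
  (∫ ω in {ω | V ω ≥ -z - βh * w}, (V ω + w) ∂P)
    - z * (P {ω | V ω < -z - βh * w}).toReal

/-- Integrating against the exponential measure up to `a ≥ 0` amounts to integrating against its
density over `[0, a]`. -/
lemma setIntegral_Iic_expMeasure {r a : ℝ} (hr : 0 < r) (ha : 0 ≤ a) (f : ℝ → ℝ) :
    ∫ x in Iic a, f x ∂(expMeasure r) = ∫ x in 0..a, r * Real.exp (-(r * x)) * f x := by
  have hdens : expMeasure r
      = volume.withDensity fun x => ENNReal.ofReal (exponentialPDFReal r x) := rfl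
  rw [hdens, setIntegral_withDensity_eq_setIntegral_toReal_smul
    (measurable_exponentialPDFReal r).ennreal_ofReal (by simp) f measurableSet_Iic,
    intervalIntegral.integral_of_le ha, ← integral_Icc_eq_integral_Ioc]
  have hpdf (x : ℝ) : exponentialPDFReal r x = if 0 ≤ x then r * Real.exp (-(r * x)) else 0 := by
    simp [exponentialPDFReal, gammaPDFReal]
  have hsub : Icc 0 a ⊆ Iic a := fun x hx => hx.2
  rw [setIntegral_eq_of_subset_of_forall_sdiff_eq_zero measurableSet_Iic hsub]
  · refine setIntegral_congr_fun measurableSet_Icc fun x hx => ?_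
    simp only [ENNReal.toReal_ofReal (exponentialPDFReal_nonneg hr x), smul_eq_mul]
    rw [hpdf, if_pos hx.1]
  · intro x hx
    have hneg : ¬ 0 ≤ x := fun h => hx.2 ⟨h, hx.1⟩
    simp [hpdf, hneg]

lemma integral_exp_density_mul_sub {r : ℝ} (hr : r ≠ 0) (a w : ℝ) :
    ∫ x in 0..a, r * Real.exp (-(r * x)) * (-x + w)
      = w - 1 / r + Real.exp (-(r * a)) * (a + 1 / r - w) := by
  have hderiv (x : ℝ) : HasDerivAt (fun y => Real.exp (-(r * y)) * (y + 1 / r - w))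
      (r * Real.exp (-(r * x)) * (-x + w)) x := by
    have hexp := ((hasDerivAt_id x).const_mul r).neg.exp
    have hlin := ((hasDerivAt_id x).add_const (1 / r)).sub_const w
    refine (hexp.mul hlin).congr_deriv ?_
    simp only [Pi.neg_apply, id_eq]
    field_simp
    ring
  rw [intervalIntegral.integral_eq_sub_of_hasDerivAt (fun x _ => hderiv x)
    (Continuous.intervalIntegrable (by fun_prop) _ _)]
  simp
  ring

/-- Exponential type model: for any actual present-bias factor `β ∈ [0,1]` and penalty
`z ≥ -β·w`, the expected social welfare from the assigned agent is
`E[(V + w)·1{V ≥ -z - β·w}] = w - 1/λ + e^{-λ(β·w + z)}·(1/λ - (1 - β)·w + z)`. -/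
theorem welfare_exponential {Ω : Type*} [MeasurableSpace Ω] (P : Measure Ω)
    [IsProbabilityMeasure P] (V : Ω → ℝ) (hV : Measurable V)
    (lam : ℝ) (hlam : 0 < lam)
    (hVexp : Measure.map (fun ω => -V ω) P = expMeasure lam)
    (w : ℝ) (hw : 0 ≤ w) (β : ℝ) (hβ : β ∈ Set.Icc (0 : ℝ) 1)
    (z : ℝ) (hz : -β * w ≤ z) :
    (∫ ω in {ω | V ω ≥ -z - β * w}, (V ω + w) ∂P)
      = w - 1 / lam + Real.exp (-lam * (β * w + z)) * (1 / lam - (1 - β) * w + z) := by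
  have hset : {ω | V ω ≥ -z - β * w} = (fun ω => -V ω) ⁻¹' Iic (β * w + z) := by
    ext ω
    simp only [mem_ofPred_eq, mem_preimage, mem_Iic]
    constructor <;> intro h <;> linarith
  have hmap := setIntegral_map (μ := P) (g := fun ω => -V ω) (f := fun x => -x + w)
    (measurableSet_Iic (a := β * w + z)) (by fun_prop) (by fun_prop)
  simp only [neg_neg] at hmap
  rw [hset, ← hmap, hVexp, setIntegral_Iic_expMeasure hlam (by linarith),
    integral_exp_density_mul_sub hlam.ne', neg_mul]
  ring
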